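/- arXiv:1910.11478 — 3 statements merged into one kernel-verified Lean document; each statement's English description precedes it below -/
import Mathlib

section
/- Let ε > 0 and 0 < δ < 1, and let n be a natural number with n ≥ 2·((2+ε)/ε)²·ln(2/δ). Let Z be a random variable with the binomial distribution Binomial(n, 1/2). Then for all integers a, b with |a − b| ≤ 1 and every set S of integers, P(a + Z ∈ S) ≤ e^ε · P(b + Z ∈ S) + δ. (That is, the Binomial Mechanism with p = 1/2, applied to an integer-valued query of sensitivity 1, is (ε,δ)-differentially private whenever n ≥ 2·((2+ε)/ε)²·ln(2/δ).) -/
open MeasureTheory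

/-- The probability mass function of `Binomial(n, 1/2)`, extended by zero to the integers. -/
noncomputable def binomialHalf (n : ℕ) (m : ℤ) : ℝ :=
  if 0 ≤ m then (n.choose m.toNat : ℝ) * (1 / 2) ^ n else 0

lemma binomialHalf_natCast (n k : ℕ) :
    binomialHalf n k = (n.choose k : ℝ) * (1 / 2) ^ n := by
  simp [binomialHalf]

lemma binomialHalf_of_neg (n : ℕ) {m : ℤ} (hm : m < 0) : binomialHalf n m = 0 := by
  simp [binomialHalf, hm]

lemma binomialHalf_of_lt (n : ℕ) {m : ℤ} (hm : n < m) : binomialHalf n m = 0 := by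
  obtain ⟨k, rfl⟩ := Int.eq_ofNat_of_zero_le (show 0 ≤ m by omega)
  rw [binomialHalf_natCast, Nat.choose_eq_zero_of_lt (by omega)]
  simp

lemma binomialHalf_nonneg (n : ℕ) (m : ℤ) : 0 ≤ binomialHalf n m := by
  unfold binomialHalf
  split_ifs <;> positivity

lemma binomialHalf_sub (n : ℕ) (m : ℤ) : binomialHalf n (n - m) = binomialHalf n m := by
  rcases lt_or_ge m 0 with h | h
  · rw [binomialHalf_of_neg n h, binomialHalf_of_lt n (by omega)]
  rcases lt_or_ge (n : ℤ) m with h' | h'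
  · rw [binomialHalf_of_lt n h', binomialHalf_of_neg n (by omega)]
  obtain ⟨k, rfl⟩ := Int.eq_ofNat_of_zero_le h
  have hk : k ≤ n := by omega
  rw [← Nat.cast_sub hk, binomialHalf_natCast, binomialHalf_natCast, Nat.choose_symm hk]

/-- The moment generating function of the centered `Binomial(n, 1/2)` distribution. -/
lemma sum_choose_mul_exp (n : ℕ) (x : ℝ) :
    ∑ k ∈ Finset.range (n + 1),
      (n.choose k : ℝ) * (1 / 2) ^ n * Real.exp (2 * x * (k - n / 2)) = Real.cosh x ^ n := by
  rw [Real.cosh_eq, add_div, add_pow]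
  refine Finset.sum_congr rfl fun k hk => ?_
  have hk : k ≤ n := Nat.lt_succ_iff.mp (Finset.mem_range.mp hk)
  have hpow : ((1 : ℝ) / 2) ^ n = (1 / 2) ^ k * (1 / 2) ^ (n - k) := by
    rw [← pow_add, Nat.add_sub_cancel' hk]
  have hexp : Real.exp (2 * x * (k - n / 2)) = Real.exp x ^ k * Real.exp (-x) ^ (n - k) := by
    rw [← Real.exp_nat_mul, ← Real.exp_nat_mul, ← Real.exp_add, Nat.cast_sub hk]
    ring_nf
  rw [hpow, hexp, div_eq_mul_one_div (Real.exp x), div_eq_mul_one_div (Real.exp (-x)),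
    mul_pow, mul_pow]
  ring

lemma tsum_binomialHalf_mul_exp (n : ℕ) (x d : ℝ) :
    ∑' m : ℤ, ENNReal.ofReal (binomialHalf n m * Real.exp (2 * x * (m - n / 2) + d))
      = ENNReal.ofReal (Real.cosh x ^ n * Real.exp d) := by
  rw [tsum_eq_sum (s := (Finset.range (n + 1)).map Nat.castEmbedding), Finset.sum_map,
    ← ENNReal.ofReal_sum_of_nonneg, ← sum_choose_mul_exp, Finset.sum_mul]
  · congr 1
    refine Finset.sum_congr rfl fun k _ => ?_
    simp only [Nat.castEmbedding_apply, binomialHalf_natCast, Int.cast_natCast, Real.exp_add]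
    ring
  · intro k _
    exact mul_nonneg (binomialHalf_nonneg _ _) (Real.exp_pos _).le
  · intro m hm
    have : binomialHalf n m = 0 := by
      rcases lt_or_ge m 0 with h | h
      · exact binomialHalf_of_neg n h
      obtain ⟨k, rfl⟩ := Int.eq_ofNat_of_zero_le h
      refine binomialHalf_of_lt n ?_
      by_contra hk
      exact hm (Finset.mem_map.mpr ⟨k, Finset.mem_range.mpr (by omega), rfl⟩)
    simp [this]

/-- Neighbouring binomial weights have ratio at most `E`, up to an exponentially tilted error that
is at least one wherever the ratio is exceeded. -/
lemma binomialHalf_le_succ (n : ℕ) {E : ℝ} (hE : 1 < E) (m : ℤ) :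
    binomialHalf n m ≤ E * binomialHalf n (m + 1) + binomialHalf n m *
      Real.exp (2 * ((E - 1) / (E + 1)) * (m - n / 2)
        + (2 * ((E - 1) / (E + 1)) * (1 / (E + 1)) - n * ((E - 1) / (E + 1)) ^ 2)) := by
  have hp := binomialHalf_nonneg n m
  have hp' := binomialHalf_nonneg n (m + 1)
  rcases lt_or_ge m 0 with h | h
  · rw [binomialHalf_of_neg n h]
    nlinarith
  rcases lt_or_ge (n : ℤ) m with h' | h'
  · rw [binomialHalf_of_lt n h']
    nlinarith
  obtain ⟨k, rfl⟩ := Int.eq_ofNat_of_zero_le h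
  have hk : k ≤ n := by omega
  rcases le_or_gt ((k : ℝ) + 1) (E * (n - k)) with hgood | hbad
  · have hrec : (n.choose (k + 1) : ℝ) * (k + 1) = n.choose k * (n - k) := by
      rw [← Nat.cast_sub hk]
      exact_mod_cast Nat.choose_succ_right_eq n k
    have hle : binomialHalf n k ≤ E * binomialHalf n ((k : ℤ) + 1) := by
      rw [← Nat.cast_succ, binomialHalf_natCast, binomialHalf_natCast, ← mul_assoc]
      refine mul_le_mul_of_nonneg_right ?_ (by positivity)
      have hc : (0 : ℝ) ≤ n.choose k := Nat.cast_nonneg _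
      refine le_of_mul_le_mul_right (a := (k : ℝ) + 1) ?_ (by positivity)
      calc (n.choose k : ℝ) * (k + 1) ≤ n.choose k * (E * (n - k)) := by gcongr
        _ = E * n.choose (k + 1) * (k + 1) := by rw [mul_assoc E, hrec]; ring
    have := mul_nonneg hp (Real.exp_pos (2 * ((E - 1) / (E + 1)) * (((k : ℤ) : ℝ) - n / 2)
        + (2 * ((E - 1) / (E + 1)) * (1 / (E + 1)) - n * ((E - 1) / (E + 1)) ^ 2))).le
    exact hle.trans (le_add_of_nonneg_right this)
  · refine le_add_of_nonneg_of_le (by positivity) (le_mul_of_one_le_right hp ?_)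
    rw [Real.one_le_exp_iff]
    have heq : 2 * ((E - 1) / (E + 1)) * (((k : ℤ) : ℝ) - n / 2)
        + (2 * ((E - 1) / (E + 1)) * (1 / (E + 1)) - n * ((E - 1) / (E + 1)) ^ 2)
        = 2 * (E - 1) / (E + 1) ^ 2 * (k + 1 - E * (n - k)) := by
      have : E + 1 ≠ 0 := by linarith
      push_cast
      field_simp
      ring
    rw [heq]
    have h1 : 0 ≤ E - 1 := by linarith
    have h2 : 0 ≤ k + 1 - E * (n - k) := by linarith
    positivity

/-- Domination of the point masses up to a summable error gives domination of the measures. -/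
lemma measure_le_of_forall_singleton_le {α : Type*} [Countable α] [MeasurableSpace α]
    [MeasurableSingletonClass α] (μ ν : Measure α) (c : ENNReal) (r : α → ENNReal)
    (h : ∀ x, μ {x} ≤ c * ν {x} + r x) (S : Set α) : μ S ≤ c * ν S + ∑' x, r x := by
  have hS : MeasurableSet S := S.to_countable.measurableSet
  rw [← μ.tsum_indicator_apply_singleton S hS, ← ν.tsum_indicator_apply_singleton S hS,
    ← ENNReal.tsum_mul_left, ← ENNReal.tsum_add]
  refine ENNReal.tsum_le_tsum fun x => ?_
  by_cases hx : x ∈ S <;> simp [hx, h x]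

lemma cosh_pow_mul_exp_le {ε δ : ℝ} (hε : 0 < ε) (hδ0 : 0 < δ) {n : ℕ}
    (hn : 2 * ((2 + ε) / ε) ^ 2 * Real.log (2 / δ) ≤ (n : ℝ)) {E t : ℝ} (hE : 1 + ε ≤ E)
    (ht : t = (E - 1) / (E + 1)) :
    Real.cosh t ^ n * Real.exp (2 * t * (1 / (E + 1)) - n * t ^ 2) ≤ δ := by
  have hE1 : 0 < E + 1 := by linarith
  have hs : ε / (2 + ε) ≤ t := by
    rw [ht, div_le_div_iff₀ (by linarith) hE1]
    nlinarith
  have hs0 : 0 < ε / (2 + ε) := by positivity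
  have hlog : 2 * Real.log (2 / δ) ≤ n * t ^ 2 := by
    calc 2 * Real.log (2 / δ)
        = 2 * ((2 + ε) / ε) ^ 2 * Real.log (2 / δ) * (ε / (2 + ε)) ^ 2 := by field_simp
      _ ≤ n * (ε / (2 + ε)) ^ 2 := by gcongr
      _ ≤ n * t ^ 2 := by gcongr
  have hshift : 2 * t * (1 / (E + 1)) ≤ 1 / 4 := by
    have : 2 * t * (1 / (E + 1)) = 2 * (E - 1) / (E + 1) ^ 2 := by rw [ht]; field_simp
    rw [this, div_le_div_iff₀ (by positivity) (by norm_num)]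
    nlinarith [sq_nonneg (E - 3)]
  have hlog2 := Real.log_two_gt_d9
  rw [Real.log_div two_ne_zero hδ0.ne'] at hlog
  calc Real.cosh t ^ n * Real.exp (2 * t * (1 / (E + 1)) - n * t ^ 2)
      ≤ Real.exp (t ^ 2 / 2) ^ n * Real.exp (2 * t * (1 / (E + 1)) - n * t ^ 2) := by
        gcongr
        exact Real.cosh_le_exp_half_sq t
    _ = Real.exp (n * (t ^ 2 / 2) + (2 * t * (1 / (E + 1)) - n * t ^ 2)) := by
        rw [← Real.exp_nat_mul, ← Real.exp_add]
    _ ≤ Real.exp (Real.log δ) := Real.exp_le_exp.mpr (by linarith)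
    _ = δ := Real.exp_log hδ0

/-- The Binomial Mechanism with `p = 1/2`, applied to an integer-valued query of
sensitivity 1, is `(ε, δ)`-differentially private whenever
`n ≥ 2 ((2+ε)/ε)² ln(2/δ)`. -/
theorem binomial_mechanism_dp
    {Ω : Type*} [MeasurableSpace Ω] (ℙ : Measure Ω) [IsProbabilityMeasure ℙ]
    (ε δ : ℝ) (hε : 0 < ε) (hδ0 : 0 < δ) (hδ1 : δ < 1)
    (n : ℕ) (hn : 2 * ((2 + ε) / ε) ^ 2 * Real.log (2 / δ) ≤ (n : ℝ))
    (Z : Ω → ℕ) (hZmeas : Measurable Z)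
    (hZ : ∀ k : ℕ, ℙ {ω | Z ω = k} = ENNReal.ofReal ((n.choose k : ℝ) * (1 / 2) ^ n))
    (a b : ℤ) (hab : |a - b| ≤ 1) (S : Set ℤ) :
    ℙ {ω | a + (Z ω : ℤ) ∈ S}
      ≤ ENNReal.ofReal (Real.exp ε) * ℙ {ω | b + (Z ω : ℤ) ∈ S}
        + ENNReal.ofReal δ := by
  have hE : 1 + ε ≤ Real.exp ε := by linarith [Real.add_one_le_exp ε]
  have hE1 : 1 < Real.exp ε := by linarith
  have hmeas : ∀ c : ℤ, Measurable fun ω => c + (Z ω : ℤ) := fun c =>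
    (measurable_from_top (f := fun k : ℕ => c + (k : ℤ))).comp hZmeas
  have hmap : ∀ (c : ℤ) (T : Set ℤ),
      ℙ.map (fun ω => c + (Z ω : ℤ)) T = ℙ {ω | c + (Z ω : ℤ) ∈ T} := fun c T =>
    Measure.map_apply (hmeas c) T.to_countable.measurableSet
  have hpoint : ∀ c x : ℤ, ℙ.map (fun ω => c + (Z ω : ℤ)) {x}
      = ENNReal.ofReal (binomialHalf n (x - c)) := by
    intro c x
    rw [hmap]
    rcases lt_or_ge (x - c) 0 with h | h
    · rw [binomialHalf_of_neg n h, ENNReal.ofReal_zero]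
      convert measure_empty (μ := ℙ)
      ext ω
      simp only [Set.mem_singleton_iff, Set.mem_ofPred_eq, Set.mem_empty_iff_false, iff_false]
      omega
    · obtain ⟨k, hk⟩ := Int.eq_ofNat_of_zero_le h
      rw [hk, binomialHalf_natCast, ← hZ k]
      congr 1
      ext ω
      simp only [Set.mem_singleton_iff, Set.mem_ofPred_eq]
      omega
  obtain ⟨t, ht⟩ : ∃ t, t = (Real.exp ε - 1) / (Real.exp ε + 1) := ⟨_, rfl⟩
  obtain ⟨d, hd⟩ : ∃ d, d = 2 * t * (1 / (Real.exp ε + 1)) - n * t ^ 2 := ⟨_, rfl⟩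
  have hup : ∀ m : ℤ, binomialHalf n m ≤ Real.exp ε * binomialHalf n (m + 1)
      + binomialHalf n m * Real.exp (2 * t * (m - n / 2) + d) := fun m => by
    rw [hd, ht]
    exact binomialHalf_le_succ n hE1 m
  have hdown : ∀ m : ℤ, binomialHalf n m ≤ Real.exp ε * binomialHalf n (m - 1)
      + binomialHalf n m * Real.exp (2 * (-t) * (m - n / 2) + d) := fun m => by
    have h := hup (n - m)
    rw [show (n : ℤ) - m + 1 = n - (m - 1) by ring, binomialHalf_sub, binomialHalf_sub] at h
    convert h using 4
    push_cast
    ring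
  have htail : Real.cosh t ^ n * Real.exp d ≤ δ := hd ▸ cosh_pow_mul_exp_le hε hδ0 hn hE ht
  have key : ∀ x : ℝ, Real.cosh x = Real.cosh t →
      (∀ m : ℤ, binomialHalf n m ≤ Real.exp ε * binomialHalf n (m + (a - b))
        + binomialHalf n m * Real.exp (2 * x * (m - n / 2) + d)) →
      ℙ {ω | a + (Z ω : ℤ) ∈ S}
        ≤ ENNReal.ofReal (Real.exp ε) * ℙ {ω | b + (Z ω : ℤ) ∈ S} + ENNReal.ofReal δ := by
    intro x hx h
    rw [← hmap, ← hmap]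
    refine (measure_le_of_forall_singleton_le _
      (ℙ.map fun ω => b + (Z ω : ℤ)) (ENNReal.ofReal (Real.exp ε))
      (fun y => ENNReal.ofReal (binomialHalf n (y - a)
        * Real.exp (2 * x * ((y - a : ℤ) - n / 2) + d))) (fun y => ?_) S).trans ?_
    · rw [hpoint, hpoint, ← ENNReal.ofReal_mul (Real.exp_pos ε).le, ← ENNReal.ofReal_add
        (mul_nonneg (Real.exp_pos ε).le (binomialHalf_nonneg _ _))
        (mul_nonneg (binomialHalf_nonneg _ _) (Real.exp_pos _).le)]
      refine ENNReal.ofReal_le_ofReal ?_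
      have := h (y - a)
      rwa [show y - a + (a - b) = y - b by ring] at this
    · gcongr
      refine ((Equiv.subRight a).tsum_eq fun m : ℤ => ENNReal.ofReal (binomialHalf n m
        * Real.exp (2 * x * (m - n / 2) + d))).trans_le ?_
      rw [tsum_binomialHalf_mul_exp, hx]
      exact ENNReal.ofReal_le_ofReal htail
  obtain h | h | h : a - b = 0 ∨ a - b = 1 ∨ a - b = -1 := by
    rw [abs_le] at hab
    omega
  · obtain rfl : a = b := by omega
    exact le_add_right (le_mul_of_one_le_left' (ENNReal.one_le_ofReal.mpr hE1.le))
  · exact key t rfl fun m => h ▸ hup m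
  · exact key (-t) (Real.cosh_neg t) fun m => h ▸ hdown m
end

section
/- Let ε > 0, let n be an even natural number, and let r be an integer with 0 ≤ n/2 + r and r ≤ (ε·n − 2)/(4 + 2ε). Then C(n, n/2 + r)·(1/2)^n ≤ e^ε · C(n, n/2 + r + 1)·(1/2)^n; that is, for X ~ Binomial(n, 1/2), P(X = n/2 + r) ≤ e^ε · P(X = n/2 + r + 1). -/
/-- If `k + 1 ≤ c * (n - k)` with `c ≥ 0`, then `C(n, k) ≤ c * C(n, k + 1)`. -/
theorem Nat.cast_choose_le_mul_choose_succ {n k : ℕ} {c : ℝ} (hc : 0 ≤ c)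
    (h : (k : ℝ) + 1 ≤ c * ((n : ℝ) - k)) :
    (n.choose k : ℝ) ≤ c * n.choose (k + 1) := by
  have hpos : (0 : ℝ) < (n : ℝ) - k :=
    pos_of_mul_pos_right (lt_of_lt_of_le (by positivity) h) hc
  have hkn : k ≤ n := by
    have : (k : ℝ) ≤ n := by linarith
    exact_mod_cast this
  have hrec : (n.choose (k + 1) : ℝ) * (k + 1) = n.choose k * ((n : ℝ) - k) := by
    rw [← Nat.cast_sub hkn]
    exact_mod_cast Nat.choose_succ_right_eq n k
  refine le_of_mul_le_mul_right ?_ hpos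
  calc (n.choose k : ℝ) * ((n : ℝ) - k) = n.choose (k + 1) * (k + 1) := hrec.symm
    _ ≤ n.choose (k + 1) * (c * ((n : ℝ) - k)) := by gcongr
    _ = c * n.choose (k + 1) * ((n : ℝ) - k) := by ring

/-- For `ε > 0`, an even natural number `n`, and an integer `r` with
`0 ≤ n/2 + r` and `r ≤ (ε·n − 2)/(4 + 2ε)`, we have
`C(n, n/2 + r)·(1/2)^n ≤ e^ε · C(n, n/2 + r + 1)·(1/2)^n`;
that is, for `X ~ Binomial(n, 1/2)`, `P(X = n/2 + r) ≤ e^ε · P(X = n/2 + r + 1)`. -/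
theorem binomial_pmf_ratio_bound
    (ε : ℝ) (hε : 0 < ε) (n : ℕ) (hn : Even n) (r : ℤ)
    (h1 : 0 ≤ (n : ℤ) / 2 + r)
    (h2 : (r : ℝ) ≤ (ε * (n : ℝ) - 2) / (4 + 2 * ε)) :
    (n.choose ((n : ℤ) / 2 + r).toNat : ℝ) * (1 / 2) ^ n
      ≤ Real.exp ε * ((n.choose (((n : ℤ) / 2 + r).toNat + 1) : ℝ) * (1 / 2) ^ n) := by
  obtain ⟨m, rfl⟩ := hn
  have hhalf : ((m + m : ℕ) : ℤ) / 2 = m := by omega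
  rw [hhalf] at h1 ⊢
  obtain ⟨k, hk⟩ := Int.eq_ofNat_of_zero_le h1
  rw [hk, Int.toNat_natCast]
  have hkr : (m : ℝ) + r = k := by exact_mod_cast hk
  rw [le_div_iff₀ (by positivity)] at h2
  push_cast at h2
  have hratio : (k : ℝ) + 1 ≤ (1 + ε) * (((m + m : ℕ) : ℝ) - k) := by
    push_cast
    rw [← hkr]
    linarith
  have hexp : 1 + ε ≤ Real.exp ε := by linarith [Real.add_one_le_exp ε]
  rw [← mul_assoc]
  gcongr
  exact (Nat.cast_choose_le_mul_choose_succ (by positivity) hratio).trans (by gcongr)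
end

section
/- Let Δ > 0, σ > 0, ε ≥ 0 and δ ∈ [0,1]. Let Z be a random variable with the Gaussian distribution N(0, σ²) on ℝ. If for all μ, ν ∈ ℝ with |μ − ν| ≤ Δ and every Borel set S ⊆ ℝ it holds that P(μ + Z ∈ S) ≤ e^ε · P(ν + Z ∈ S) + δ, then Φ(Δ/(2σ) − ε·σ/Δ) − e^ε · Φ(−Δ/(2σ) − ε·σ/Δ) ≤ δ. (Necessity direction of the Analytic Gaussian Mechanism.) -/
open MeasureTheory ProbabilityTheory

/-- The cumulative distribution function `Φ` of the standard normal distribution. -/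
noncomputable def stdNormalCDF (t : ℝ) : ℝ :=
  ((gaussianReal 0 1) (Set.Iic t)).toReal

/-- If `Z ~ N(0, σ²)`, then `P(m + Z ≤ a) = Φ((a - m)/σ)`. -/
lemma measure_add_mem_Iic_eq_stdNormalCDF {Ω : Type*} [MeasurableSpace Ω] {P : Measure Ω}
    {σ : ℝ} (hσ : 0 < σ) {Z : Ω → ℝ} (hZmeas : Measurable Z)
    (hZ : Measure.map Z P = gaussianReal 0 (Real.toNNReal (σ ^ 2))) (m a : ℝ) :
    P {ω | m + Z ω ∈ Set.Iic a} = ENNReal.ofReal (stdNormalCDF ((a - m) / σ)) := by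
  have hscale : gaussianReal 0 (Real.toNNReal (σ ^ 2)) = (gaussianReal 0 1).map (σ * ·) := by
    rw [gaussianReal_map_const_mul, mul_zero, mul_one]
    congr 1
    exact Real.toNNReal_of_nonneg (sq_nonneg σ)
  have hZpre : {ω | m + Z ω ∈ Set.Iic a} = Z ⁻¹' Set.Iic (a - m) := by
    ext ω
    simp [le_sub_iff_add_le']
  have hpre : (σ * ·) ⁻¹' Set.Iic (a - m) = Set.Iic ((a - m) / σ) := by
    ext x
    simp [le_div_iff₀' hσ]
  rw [hZpre, ← Measure.map_apply hZmeas measurableSet_Iic, hZ, hscale,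
    Measure.map_apply (measurable_const_mul σ) measurableSet_Iic, hpre, stdNormalCDF,
    ENNReal.ofReal_toReal (measure_ne_top _ _)]

/-- Necessity direction of the Analytic Gaussian Mechanism: if adding `N(0, σ²)`
noise to a real-valued query of sensitivity `Δ` is `(ε, δ)`-differentially private,
then `Φ(Δ/(2σ) − εσ/Δ) − e^ε Φ(−Δ/(2σ) − εσ/Δ) ≤ δ`. -/
theorem analytic_gaussian_mechanism_necessary
    {Ω : Type*} [MeasurableSpace Ω] (P : Measure Ω) [IsProbabilityMeasure P]
    (Δ σ ε δ : ℝ) (hΔ : 0 < Δ) (hσ : 0 < σ) (hε : 0 ≤ ε) (hδ0 : 0 ≤ δ) (hδ1 : δ ≤ 1)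
    (Z : Ω → ℝ) (hZmeas : Measurable Z)
    (hZ : Measure.map Z P = gaussianReal 0 (Real.toNNReal (σ ^ 2)))
    (hdp : ∀ μ ν : ℝ, |μ - ν| ≤ Δ → ∀ S : Set ℝ, MeasurableSet S →
      P {ω | μ + Z ω ∈ S}
        ≤ ENNReal.ofReal (Real.exp ε) * P {ω | ν + Z ω ∈ S} + ENNReal.ofReal δ) :
    stdNormalCDF (Δ / (2 * σ) - ε * σ / Δ)
      - Real.exp ε * stdNormalCDF (-(Δ / (2 * σ)) - ε * σ / Δ) ≤ δ := by
  have h := hdp 0 Δ (by simp [abs_of_pos hΔ])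
    (Set.Iic (σ * (Δ / (2 * σ) - ε * σ / Δ))) measurableSet_Iic
  have hfst : (σ * (Δ / (2 * σ) - ε * σ / Δ) - 0) / σ = Δ / (2 * σ) - ε * σ / Δ := by
    field_simp
    ring
  have hsnd : (σ * (Δ / (2 * σ) - ε * σ / Δ) - Δ) / σ = -(Δ / (2 * σ)) - ε * σ / Δ := by
    field_simp
    ring
  have hnonneg : 0 ≤ Real.exp ε * stdNormalCDF (-(Δ / (2 * σ)) - ε * σ / Δ) :=
    mul_nonneg (Real.exp_pos ε).le ENNReal.toReal_nonneg
  rw [measure_add_mem_Iic_eq_stdNormalCDF hσ hZmeas hZ,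
    measure_add_mem_Iic_eq_stdNormalCDF hσ hZmeas hZ, hfst, hsnd,
    ← ENNReal.ofReal_mul (Real.exp_pos ε).le, ← ENNReal.ofReal_add hnonneg hδ0,
    ENNReal.ofReal_le_ofReal_iff (add_nonneg hnonneg hδ0)] at h
  linarith
end
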